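/- Let ω : ℝ → ℝ and x ∈ ℝ, and suppose that ω(t) → a as t → x from the left (along the punctured left neighborhood filter) and ω(t) → b as t → x from the right. Let (xₙ) and (yₙ) be real sequences with xₙ < x < yₙ for all n and xₙ → x, yₙ → x. Then liminf_{n→∞} essinf_{(xₙ, yₙ)} ω ≥ min{a, b}, where essinf_{(xₙ,yₙ)} ω denotes the essential infimum of ω with respect to Lebesgue measure restricted to the open interval (xₙ, yₙ). -/

import Mathlib

open MeasureTheory Filter Set
open scoped ENNReal

/-- A property that holds on a punctured neighborhood of `x` holds almost everywhere on
intervals whose endpoints are close enough to `x`. -/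
theorem eventually_ae_restrict_Ioo_of_eventually_nhdsNE {ι : Type*} {l : Filter ι}
    {p : ℝ → Prop} {x : ℝ} {u v : ι → ℝ} (hp : ∀ᶠ t in nhdsWithin x {x}ᶜ, p t)
    (hu : Tendsto u l (nhds x)) (hv : Tendsto v l (nhds x)) :
    ∀ᶠ i in l, ∀ᵐ t ∂volume.restrict (Ioo (u i) (v i)), p t := by
  rw [eventually_nhdsWithin_iff] at hp
  obtain ⟨c, d, hx, hcd⟩ := mem_nhds_iff_exists_Ioo_subset.mp hp
  filter_upwards [hu.eventually (lt_mem_nhds hx.1), hv.eventually (gt_mem_nhds hx.2)]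
    with i hi hi'
  filter_upwards [ae_restrict_mem measurableSet_Ioo,
    ae_restrict_of_ae (Measure.ae_ne volume x)] with t ht hne
  exact hcd ⟨hi.trans ht.1, ht.2.trans hi'⟩ hne

/-- The essential infimum of a function with values almost everywhere in `[c, d]` lies in
`[c, d]`. -/
theorem essInf_mem_Icc_of_ae_mem_Icc {α : Type*} {m : MeasurableSpace α} {μ : Measure α}
    [NeZero μ] {f : α → ℝ} {c d : ℝ} (h : ∀ᵐ t ∂μ, f t ∈ Icc c d) :
    essInf f μ ∈ Icc c d := by
  have hc : ∀ᵐ t ∂μ, c ≤ f t := h.mono fun _ ht => ht.1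
  have hd : ∀ᵐ t ∂μ, f t ≤ d := h.mono fun _ ht => ht.2
  exact ⟨le_liminf_of_le (isBoundedUnder_of_eventually_le hd).isCoboundedUnder_ge hc,
    liminf_le_of_frequently_le hd.frequently (isBoundedUnder_of_eventually_ge hc)⟩

/-- Part 1 of Lemma 2.4: for a function with one-sided limits `a` (from the left) and
`b` (from the right) at `x`, the liminf of the essential infima over shrinking open
intervals around `x` is at least `min a b`. -/
theorem liminf_essInf_ge_min_one_sided_limits
    (ω : ℝ → ℝ) (x a b : ℝ)
    (ha : Tendsto ω (nhdsWithin x (Set.Iio x)) (nhds a))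
    (hb : Tendsto ω (nhdsWithin x (Set.Ioi x)) (nhds b))
    (xn yn : ℕ → ℝ) (hxy : ∀ n, xn n < x ∧ x < yn n)
    (hxn : Tendsto xn atTop (nhds x)) (hyn : Tendsto yn atTop (nhds x)) :
    min a b ≤ Filter.liminf (fun n =>
      essInf ω (volume.restrict (Set.Ioo (xn n) (yn n)))) atTop := by
  refine le_of_forall_lt_imp_le_of_dense fun c hc => ?_
  obtain ⟨hca, hcb⟩ := lt_min_iff.mp hc
  obtain ⟨d, hd⟩ := exists_gt (max a b)
  obtain ⟨had, hbd⟩ := max_lt_iff.mp hd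
  have hω : ∀ᶠ t in nhdsWithin x {x}ᶜ, ω t ∈ Icc c d := by
    rw [← nhdsLT_sup_nhdsGT, eventually_sup]
    exact ⟨ha.eventually (Icc_mem_nhds hca had), hb.eventually (Icc_mem_nhds hcb hbd)⟩
  have hmem : ∀ᶠ n in atTop,
      essInf ω (volume.restrict (Ioo (xn n) (yn n))) ∈ Icc c d := by
    filter_upwards [eventually_ae_restrict_Ioo_of_eventually_nhdsNE hω hxn hyn] with n hn
    have : NeZero (volume.restrict (Ioo (xn n) (yn n))) := by
      refine ⟨fun h => ?_⟩
      rw [Measure.restrict_eq_zero, Real.volume_Ioo, ENNReal.ofReal_eq_zero] at h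
      linarith [hxy n]
    exact essInf_mem_Icc_of_ae_mem_Icc hn
  exact le_liminf_of_le
    (isBoundedUnder_of_eventually_le (hmem.mono fun _ h => h.2)).isCoboundedUnder_ge
    (hmem.mono fun _ h => h.1)
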